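/- For every t̃ < T there exists ε > 0 such that for all ϱ ∈ [−ε, ε] the maximal backward solution K_·(ϱ) of the Riccati equation exists on [t̃, T] (i.e. t_ϱ < t̃) and is uniformly bounded on [t̃, T], uniformly in ϱ ∈ [−ε, ε]; moreover lim_{ϱ→0} sup_{t ∈ [t̃, T]} ‖K_t(ϱ) − K_t(0)‖ = 0. -/

import Mathlib

open Filter Matrix Set

attribute [local instance] Matrix.normedAddCommGroup Matrix.normedSpace

/-- Right-hand side of the matrix Riccati equation `−K̇ = Ric ϱ t K`. -/
noncomputable def Ric {n : ℕ}
    (H11 H12 H13 H14 H21 H22 H23 H24 H31 H32 H33 H41 H42 H44 :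
      ℝ → Matrix (Fin n) (Fin n) ℝ) (ϱ t : ℝ)
    (K : Matrix (Fin n) (Fin n) ℝ) : Matrix (Fin n) (Fin n) ℝ :=
  K * H21 t + H12 t * K + H11 t + ϱ • (K * H22 t * K)
    + (ϱ ^ 2) • ((K * H23 t + H13 t) * ((1 - K * H33 t)⁻¹ * K) * (H31 t + H32 t * K))
    + (ϱ ^ 2) • ((K * H24 t + H14 t) * ((1 - K * H44 t)⁻¹ * K) * (H41 t + H42 t * K))

lemma aux_norm_mul {n : ℕ} (A B : Matrix (Fin n) (Fin n) ℝ) : ‖A * B‖ ≤ n * ‖A‖ * ‖B‖ := by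
  rw [Matrix.norm_le_iff (by positivity)]
  intro i j
  rw [Matrix.mul_apply]
  calc ‖∑ k, A i k * B k j‖ ≤ ∑ k : Fin n, ‖A‖ * ‖B‖ := by
        refine norm_sum_le_of_le _ fun k _ => ?_
        rw [norm_mul]
        exact mul_le_mul (Matrix.norm_entry_le_entrywise_sup_norm A)
          (Matrix.norm_entry_le_entrywise_sup_norm B) (norm_nonneg _) (norm_nonneg _)
    _ = n * ‖A‖ * ‖B‖ := by simp [mul_assoc]

lemma aux_norm_mul' {n : ℕ} {A B : Matrix (Fin n) (Fin n) ℝ} {a b : ℝ} (ha : ‖A‖ ≤ a)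
    (hb : ‖B‖ ≤ b) : ‖A * B‖ ≤ n * a * b := by
  refine (aux_norm_mul A B).trans ?_
  have h1 : 0 ≤ a := (norm_nonneg A).trans ha
  gcongr

lemma aux_F {n : ℕ} {β : ℝ} (hβ : 0 < β) (K H : Matrix (Fin n) (Fin n) ℝ) (hK : K.PosSemidef)
    (hH : ∀ z : Fin n → ℝ, H.mulVec z ⬝ᵥ z ≤ -β * (z ⬝ᵥ z)) :
    ‖(1 - K * H)⁻¹ * K‖ ≤ 1 / β := by
  by_cases hu : IsUnit (1 - K * H).det
  swap
  · rw [Matrix.nonsing_inv_apply_not_isUnit _ hu]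
    simp [hβ.le]
  set F := (1 - K * H)⁻¹ * K with hF
  have hFe : (1 - K * H) * F = K := by
    rw [hF, ← Matrix.mul_assoc, Matrix.mul_nonsing_inv _ hu, Matrix.one_mul]
  have hFe2 : F = K * (1 + H * F) := by
    have : F - K * (H * F) = K := by
      rw [← Matrix.mul_assoc]; simpa [Matrix.sub_mul] using hFe
    rw [Matrix.mul_add, Matrix.mul_one]
    exact sub_eq_iff_eq_add.1 this
  rw [Matrix.norm_le_iff (by positivity)]
  intro i j
  set y : Fin n → ℝ := F.mulVec (Pi.single j 1) with hy
  have hyi : ∀ i, F i j = y i := by intro i; simp [hy]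
  set w : Fin n → ℝ := Pi.single j 1 + H.mulVec y with hw
  have hyw : y = K.mulVec w := by
    rw [hw, hy, Matrix.mulVec_mulVec]
    nth_rewrite 1 [hFe2]
    rw [← Matrix.mulVec_mulVec, Matrix.add_mulVec, Matrix.one_mulVec]
  have hpos : 0 ≤ w ⬝ᵥ y := by
    have := hK.dotProduct_mulVec_nonneg w
    rw [← hyw] at this
    simpa using this
  have h1 : w ⬝ᵥ y = y j + H.mulVec y ⬝ᵥ y := by
    rw [hw, add_dotProduct]; simp
  have h2 := hH y
  have hsq : ∀ i, y i ^ 2 ≤ y ⬝ᵥ y := by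
    intro i
    rw [pow_two]
    exact Finset.single_le_sum (f := fun i => y i * y i) (fun k _ => mul_self_nonneg _)
      (Finset.mem_univ i)
  have h3 : β * (y ⬝ᵥ y) ≤ y j := by linarith
  have h4 := hsq j
  have h5 := hsq i
  rw [hyi, Real.norm_eq_abs, le_div_iff₀ hβ]
  have h0 : 0 ≤ y j := h3.trans' (mul_nonneg hβ.le (h4.trans' (sq_nonneg _)))
  have h6 : β * y j ≤ 1 := by
    by_contra hc
    push Not at hc
    have : 0 < y j := by
      rcases h0.lt_or_eq with h | h
      · exact h
      · rw [← h] at hc; norm_num at hc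
    nlinarith
  have h7 : (y i * β) ^ 2 ≤ 1 := by
    have e1 := mul_le_mul_of_nonneg_left h5 (sq_nonneg β)
    have e2 := mul_le_mul_of_nonneg_left h3 hβ.le
    linarith
  have := (sq_le_one_iff_abs_le_one _).1 h7
  rwa [abs_mul, abs_of_pos hβ] at this

lemma aux_cmp {E : Type*} [NormedAddCommGroup E] [NormedSpace ℝ E] (f f' : ℝ → E) (t1 T L η : ℝ)
    (hη : 0 < η) (hL : 0 < L) (hf : ContinuousOn f (Set.Icc t1 T)) (hfT : f T = 0)
    (hd : ∀ t ∈ Set.Ioo t1 T, HasDerivAt f (f' t) t)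
    (hb : ∀ t ∈ Set.Ioo t1 T, ‖f t‖ = η * Real.exp (L * (T - t)) →
      ‖f' t‖ < η * Real.exp (L * (T - t)) * L) :
    ∀ t ∈ Set.Icc t1 T, ‖f t‖ ≤ η * Real.exp (L * (T - t)) := by
  intro t ht
  rcases ht.2.eq_or_lt with h | h
  · subst h; rw [hfT]; simp; positivity
  have hT : ContinuousWithinAt f (Set.Icc t1 T) T := hf T ⟨ht.1.trans ht.2, le_rfl⟩
  have hev : ∀ᶠ s in nhdsWithin T (Set.Iio T), ‖f s‖ < η ∧ t < s ∧ s < T := by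
    have h1 : Tendsto (fun s => ‖f s‖) (nhdsWithin T (Set.Iio T)) (nhds 0) := by
      have := hT.norm.tendsto
      simp only [hfT, norm_zero] at this
      refine this.mono_left ?_
      rw [← nhdsWithin_Ioo_eq_nhdsLT (lt_of_le_of_lt ht.1 h)]
      exact nhdsWithin_mono _ Set.Ioo_subset_Icc_self
    filter_upwards [h1.eventually (gt_mem_nhds hη), Ioo_mem_nhdsLT h] with s h1 h2
    exact ⟨h1, h2.1, h2.2⟩
  obtain ⟨s, hs1, hs2, hs3⟩ := hev.exists
  have key := image_norm_le_of_norm_deriv_right_lt_deriv_boundary (a := T - s) (b := T - t)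
    (f := fun x => f (T - x)) (f' := fun x => - f' (T - x))
    (B := fun x => η * Real.exp (L * x)) (B' := fun x => η * Real.exp (L * x) * L)
    (hf.comp (by fun_prop) (by
      intro x hx; constructor <;> linarith [hx.1, hx.2, ht.1]))
    (by
      intro x hx
      have hm : T - x ∈ Set.Ioo t1 T := by constructor <;> linarith [hx.1, hx.2, ht.1]
      have h1 := (hd _ hm).scomp x ((hasDerivAt_id x).const_sub T)
      simpa [Function.comp_def] using h1.hasDerivWithinAt)
    (by
      have : (1:ℝ) ≤ Real.exp (L * (T - s)) := Real.one_le_exp (by nlinarith)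
      simp only [sub_sub_cancel]
      nlinarith)
    (by
      intro x
      have h1 := (((hasDerivAt_id x).const_mul L).exp).const_mul η
      simpa [mul_assoc] using h1)
    (by
      intro x hx he
      have hm : T - x ∈ Set.Ioo t1 T := by constructor <;> linarith [hx.1, hx.2, ht.1]
      have := hb _ hm
      simp only [sub_sub_cancel] at this
      simpa using this he)
  have := key (x := T - t) ⟨by linarith, le_rfl⟩
  simpa using this

lemma aux_term {n : ℕ} {h f k : ℝ} (hh : 0 ≤ h) (hf : 0 ≤ f) (hk : 0 ≤ k)
    {K A B C D F : Matrix (Fin n) (Fin n) ℝ}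
    (hK : ‖K‖ ≤ k) (hA : ‖A‖ ≤ h) (hB : ‖B‖ ≤ h) (hC : ‖C‖ ≤ h) (hD : ‖D‖ ≤ h) (hF : ‖F‖ ≤ f) :
    ‖(K * A + B) * F * (C + D * K)‖ ≤ n ^ 2 * (n + 1) ^ 2 * h ^ 2 * f * (1 + k) ^ 2 := by
  have hn : (0:ℝ) ≤ n := Nat.cast_nonneg n
  have h1 : ‖K * A + B‖ ≤ (n + 1) * h * (1 + k) := by
    refine (norm_add_le_of_le (aux_norm_mul' hK hA) hB).trans ?_
    nlinarith [mul_nonneg hn hh, mul_nonneg hh hk]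
  have h2 : ‖C + D * K‖ ≤ (n + 1) * h * (1 + k) := by
    refine (norm_add_le_of_le hC (aux_norm_mul' hD hK)).trans ?_
    nlinarith [mul_nonneg hn hh, mul_nonneg hh hk]
  refine (aux_norm_mul' (aux_norm_mul' h1 hF) h2).trans (le_of_eq (by ring))

lemma aux_bound {n : ℕ} (a b : ℝ) (H : ℝ → Matrix (Fin n) (Fin n) ℝ) (hc : Continuous H) :
    ∃ C, ∀ c, C ≤ c → ∀ t ∈ Set.Icc a b, ‖H t‖ ≤ c := by
  obtain ⟨C, hC⟩ := isCompact_Icc.exists_bound_of_continuousOn (hc.continuousOn (s := Set.Icc a b))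
  exact ⟨C, fun c h t ht => (hC t ht).trans h⟩

lemma aux_Ric {n : ℕ} (T t' β : ℝ) (hβ : 0 < β)
    (H11 H12 H13 H14 H21 H22 H23 H24 H31 H32 H33 H41 H42 H44 :
      ℝ → Matrix (Fin n) (Fin n) ℝ)
    (hc11 : Continuous H11) (hc12 : Continuous H12) (hc13 : Continuous H13)
    (hc14 : Continuous H14) (hc21 : Continuous H21) (hc22 : Continuous H22)
    (hc23 : Continuous H23) (hc24 : Continuous H24) (hc31 : Continuous H31)
    (hc32 : Continuous H32) (hc41 : Continuous H41)
    (hc42 : Continuous H42)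
    (h33 : ∀ t ≤ T, ∀ z : Fin n → ℝ, (H33 t).mulVec z ⬝ᵥ z ≤ -β * (z ⬝ᵥ z))
    (h44 : ∀ t ≤ T, ∀ z : Fin n → ℝ, (H44 t).mulVec z ⬝ᵥ z ≤ -β * (z ⬝ᵥ z)) :
    ∃ M : ℝ, 0 ≤ M ∧ ∀ t ∈ Set.Icc t' T,
      (∀ K, ‖Ric H11 H12 H13 H14 H21 H22 H23 H24 H31 H32 H33 H41 H42 H44 0 t K‖
        ≤ M * (1 + ‖K‖)) ∧
      (∀ K K', ‖Ric H11 H12 H13 H14 H21 H22 H23 H24 H31 H32 H33 H41 H42 H44 0 t K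
        - Ric H11 H12 H13 H14 H21 H22 H23 H24 H31 H32 H33 H41 H42 H44 0 t K'‖
        ≤ M * ‖K - K'‖) ∧
      (∀ ϱ K, |ϱ| ≤ 1 → K.PosSemidef →
        ‖Ric H11 H12 H13 H14 H21 H22 H23 H24 H31 H32 H33 H41 H42 H44 ϱ t K
        - Ric H11 H12 H13 H14 H21 H22 H23 H24 H31 H32 H33 H41 H42 H44 0 t K‖
        ≤ |ϱ| * (M * (1 + ‖K‖) ^ 2)) := by
  obtain ⟨c11, b11⟩ := aux_bound t' T H11 hc11
  obtain ⟨c12, b12⟩ := aux_bound t' T H12 hc12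
  obtain ⟨c13, b13⟩ := aux_bound t' T H13 hc13
  obtain ⟨c14, b14⟩ := aux_bound t' T H14 hc14
  obtain ⟨c21, b21⟩ := aux_bound t' T H21 hc21
  obtain ⟨c22, b22⟩ := aux_bound t' T H22 hc22
  obtain ⟨c23, b23⟩ := aux_bound t' T H23 hc23
  obtain ⟨c24, b24⟩ := aux_bound t' T H24 hc24
  obtain ⟨c31, b31⟩ := aux_bound t' T H31 hc31
  obtain ⟨c32, b32⟩ := aux_bound t' T H32 hc32
  obtain ⟨c41, b41⟩ := aux_bound t' T H41 hc41
  obtain ⟨c42, b42⟩ := aux_bound t' T H42 hc42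
  obtain ⟨h, hh⟩ : ∃ h : ℝ, ∀ x ∈ ({0, c11, c12, c13, c14, c21, c22, c23, c24, c31, c32, c41, c42} : Finset ℝ), x ≤ h :=
    Finset.exists_le _
  have h0 : 0 ≤ h := hh 0 (by simp)
  replace b11 := b11 h (hh _ (by simp))
  replace b12 := b12 h (hh _ (by simp))
  replace b13 := b13 h (hh _ (by simp))
  replace b14 := b14 h (hh _ (by simp))
  replace b21 := b21 h (hh _ (by simp))
  replace b22 := b22 h (hh _ (by simp))
  replace b23 := b23 h (hh _ (by simp))
  replace b24 := b24 h (hh _ (by simp))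
  replace b31 := b31 h (hh _ (by simp))
  replace b32 := b32 h (hh _ (by simp))
  replace b41 := b41 h (hh _ (by simp))
  replace b42 := b42 h (hh _ (by simp))
  have hn : (0:ℝ) ≤ n := Nat.cast_nonneg n
  have hf : 0 ≤ 1 / β := by positivity
  have p1 : 0 ≤ (n:ℝ) * h := by positivity
  have p2 : 0 ≤ (n:ℝ) ^ 2 * h := by positivity
  have p3 : 0 ≤ (n:ℝ) ^ 2 * (n + 1) ^ 2 * h ^ 2 * (1 / β) := by positivity
  set G := (n:ℝ) ^ 2 * (n + 1) ^ 2 * h ^ 2 * (1 / β) with hG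
  have hR0 : ∀ t K, Ric H11 H12 H13 H14 H21 H22 H23 H24 H31 H32 H33 H41 H42 H44 0 t K
      = K * H21 t + H12 t * K + H11 t := by
    intro t K; simp [Ric]
  refine ⟨2 * (n * h) + h + n ^ 2 * h + 2 * G, by positivity, fun t ht => ⟨?_, ?_, ?_⟩⟩
  · intro K
    rw [hR0]
    refine (norm_add_le_of_le (norm_add_le_of_le (aux_norm_mul' le_rfl (b21 t ht))
      (aux_norm_mul' (b12 t ht) le_rfl)) (b11 t ht)).trans ?_
    have := norm_nonneg K
    nlinarith [mul_nonneg p1 this, mul_nonneg p2 this, mul_nonneg p3 this, mul_nonneg h0 this]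
  · intro K K'
    rw [hR0, hR0]
    have : K * H21 t + H12 t * K + H11 t - (K' * H21 t + H12 t * K' + H11 t)
      = (K - K') * H21 t + H12 t * (K - K') := by
      rw [Matrix.sub_mul, Matrix.mul_sub]; abel
    rw [this]
    refine (norm_add_le_of_le (aux_norm_mul' le_rfl (b21 t ht))
      (aux_norm_mul' (b12 t ht) le_rfl)).trans ?_
    have := norm_nonneg (K - K')
    nlinarith [mul_nonneg p1 this, mul_nonneg p2 this, mul_nonneg p3 this, mul_nonneg h0 this]
  · intro ϱ K hϱ hK
    have k0 := norm_nonneg K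
    have q1 := aux_term h0 hf k0 le_rfl (b23 t ht) (b13 t ht) (b31 t ht) (b32 t ht)
      (aux_F hβ K (H33 t) hK (h33 t ht.2))
    have q2 := aux_term h0 hf k0 le_rfl (b24 t ht) (b14 t ht) (b41 t ht) (b42 t ht)
      (aux_F hβ K (H44 t) hK (h44 t ht.2))
    have q3 : ‖K * H22 t * K‖ ≤ n ^ 2 * h * (1 + ‖K‖) ^ 2 := by
      refine (aux_norm_mul' (aux_norm_mul' le_rfl (b22 t ht)) le_rfl).trans ?_
      nlinarith [mul_nonneg p2 k0]
    rw [← hG] at q1 q2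
    have hr2 : |ϱ ^ 2| ≤ |ϱ| := by
      rw [abs_pow]; nlinarith [abs_nonneg ϱ]
    rw [hR0, Ric]
    have hs : ∀ A X Y Z : Matrix (Fin n) (Fin n) ℝ, A + X + Y + Z - A = X + Y + Z := by
      intros; abel
    rw [hs]
    refine (norm_add₃_le).trans ?_
    rw [norm_smul, norm_smul, norm_smul, Real.norm_eq_abs, Real.norm_eq_abs]
    have r1 := mul_le_mul hr2 q1 (norm_nonneg _) (abs_nonneg _)
    have r2 := mul_le_mul hr2 q2 (norm_nonneg _) (abs_nonneg _)
    have r3 := mul_le_mul_of_nonneg_left q3 (abs_nonneg ϱ)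
    have r4 : 0 ≤ |ϱ| * ((2 * (n * h) + h) * (1 + ‖K‖) ^ 2) := by positivity
    linarith

/-- locally in `ϱ` near `0`, the maximal backward solution of the
Riccati equation exists and is uniformly bounded on `[t̃, T]`, and
`sup_{t ∈ [t̃,T]} ‖K_t(ϱ) − K_t(0)‖ → 0` as `ϱ → 0`. -/
theorem stmt_5
    (T : ℝ) (hT : 0 < T) (n : ℕ) (hn : 1 ≤ n) (β : ℝ) (hβ : 0 < β)
    (H11 H12 H13 H14 H21 H22 H23 H24 H31 H32 H33 H41 H42 H44 :
      ℝ → Matrix (Fin n) (Fin n) ℝ)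
    (hc11 : Continuous H11) (hc12 : Continuous H12) (hc13 : Continuous H13)
    (hc14 : Continuous H14) (hc21 : Continuous H21) (hc22 : Continuous H22)
    (hc23 : Continuous H23) (hc24 : Continuous H24) (hc31 : Continuous H31)
    (hc32 : Continuous H32) (hc33 : Continuous H33) (hc41 : Continuous H41)
    (hc42 : Continuous H42) (hc44 : Continuous H44)
    (hsym : ∀ t : ℝ, (H11 t)ᵀ = H11 t ∧ (H12 t)ᵀ = H21 t ∧ (H13 t)ᵀ = H31 t ∧
      (H14 t)ᵀ = H41 t ∧ (H22 t)ᵀ = H22 t ∧ (H23 t)ᵀ = H32 t ∧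
      (H24 t)ᵀ = H42 t ∧ (H33 t)ᵀ = H33 t ∧ (H44 t)ᵀ = H44 t)
    (hconst : ∀ t : ℝ, t ≤ 0 → H11 t = H11 0 ∧ H12 t = H12 0 ∧ H13 t = H13 0 ∧
      H14 t = H14 0 ∧ H21 t = H21 0 ∧ H22 t = H22 0 ∧ H23 t = H23 0 ∧
      H24 t = H24 0 ∧ H31 t = H31 0 ∧ H32 t = H32 0 ∧ H33 t = H33 0 ∧
      H41 t = H41 0 ∧ H42 t = H42 0 ∧ H44 t = H44 0)
    (hmono : ∀ t : ℝ, t ≤ T → ∀ x y z θ : Fin n → ℝ,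
      -(((H11 t).mulVec x + (H12 t).mulVec y + (H13 t).mulVec z + (H14 t).mulVec θ) ⬝ᵥ x)
        + ((H21 t).mulVec x + (H22 t).mulVec y + (H23 t).mulVec z + (H24 t).mulVec θ) ⬝ᵥ y
        + ((H31 t).mulVec x + (H32 t).mulVec y + (H33 t).mulVec z) ⬝ᵥ z
        + ((H41 t).mulVec x + (H42 t).mulVec y + (H44 t).mulVec θ) ⬝ᵥ θ
        ≤ -β * (x ⬝ᵥ x + y ⬝ᵥ y + z ⬝ᵥ z + θ ⬝ᵥ θ))
    (K : ℝ → ℝ → Matrix (Fin n) (Fin n) ℝ) (tb : ℝ → EReal)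
    (htbT : ∀ ϱ : ℝ, tb ϱ < (T : EReal))
    (hterm : ∀ ϱ : ℝ, K ϱ T = 0)
    (hcont : ∀ ϱ : ℝ, ContinuousOn (K ϱ) {t : ℝ | tb ϱ < (t : EReal) ∧ t ≤ T})
    (hode : ∀ ϱ t : ℝ, tb ϱ < (t : EReal) → t < T →
      HasDerivAt (K ϱ)
        (-(Ric H11 H12 H13 H14 H21 H22 H23 H24 H31 H32 H33 H41 H42 H44 ϱ t (K ϱ t))) t)
    (hpsd : ∀ ϱ t : ℝ, tb ϱ < (t : EReal) → t ≤ T → (K ϱ t).PosSemidef)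
    (hblow : ∀ ϱ : ℝ, ⊥ < tb ϱ →
      Tendsto (fun t => ‖K ϱ t‖) (nhdsWithin (tb ϱ).toReal (Set.Ioi (tb ϱ).toReal)) atTop) :
    ∀ t' : ℝ, t' < T → ∃ ε > (0 : ℝ),
      (∀ ϱ ∈ Set.Icc (-ε) ε, tb ϱ < (t' : EReal)) ∧
      (∃ C : ℝ, ∀ ϱ ∈ Set.Icc (-ε) ε, ∀ t ∈ Set.Icc t' T, ‖K ϱ t‖ ≤ C) ∧
      Tendsto (fun ϱ => sSup ((fun t => ‖K ϱ t - K 0 t‖) '' Set.Icc t' T))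
        (nhds 0) (nhds 0) := by
  intro t' ht'
  have h33 : ∀ t ≤ T, ∀ z : Fin n → ℝ, (H33 t).mulVec z ⬝ᵥ z ≤ -β * (z ⬝ᵥ z) := by
    intro t ht z; simpa using hmono t ht 0 0 z 0
  have h44 : ∀ t ≤ T, ∀ z : Fin n → ℝ, (H44 t).mulVec z ⬝ᵥ z ≤ -β * (z ⬝ᵥ z) := by
    intro t ht z; simpa using hmono t ht 0 0 0 z
  obtain ⟨M, hM, hRic⟩ := aux_Ric T t' β hβ H11 H12 H13 H14 H21 H22 H23 H24 H31 H32 H33 H41 H42 H44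
    hc11 hc12 hc13 hc14 hc21 hc22 hc23 hc24 hc31 hc32 hc41 hc42 h33 h44
  set R := Ric H11 H12 H13 H14 H21 H22 H23 H24 H31 H32 H33 H41 H42 H44 with hR
  clear_value R
  set L := 2 * M + 1 with hL
  have hL0 : 0 < L := by positivity
  set S := Real.exp (L * (T - t')) with hS
  have hS1 : 1 ≤ S := Real.one_le_exp (by nlinarith)
  set ε := 1 / (4 * M * S + 1) with hε
  have hden : 0 < 4 * M * S + 1 := by positivity
  have hε0 : 0 < ε := by positivity
  have hε1 : ε ≤ 1 := by
    rw [hε, div_le_one hden]; nlinarith [mul_nonneg hM (by linarith : 0 ≤ S)]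
  have hεM : ε * (4 * M * S) < 1 := by
    have : ε * (4 * M * S + 1) = 1 := by rw [hε]; field_simp
    linarith
  have hexp : ∀ t, t' ≤ t → Real.exp (L * (T - t)) ≤ S := by
    intro t h; apply Real.exp_le_exp.2; nlinarith
  -- a priori bound
  have hbd : ∀ ϱ ∈ Set.Icc (-ε) ε, ∀ t : ℝ, tb ϱ < (t : EReal) → t' ≤ t → t ≤ T → ‖K ϱ t‖ ≤ S := by
    intro ϱ hϱ t1 h1 h2 h3
    have hra : |ϱ| ≤ ε := abs_le.2 hϱ
    have := aux_cmp (K ϱ) (fun t => -(R ϱ t (K ϱ t))) t1 T L 1 one_pos hL0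
      ((hcont ϱ).mono fun s hs => ⟨h1.trans_le (EReal.coe_le_coe_iff.2 hs.1), hs.2⟩) (hterm ϱ)
      (fun t ht => hode ϱ t (h1.trans (EReal.coe_lt_coe_iff.2 ht.1)) ht.2)
      (by
        intro t ht he
        have htt : tb ϱ < (t : EReal) := h1.trans (EReal.coe_lt_coe_iff.2 ht.1)
        obtain ⟨a1, -, a3⟩ := hRic t ⟨h2.trans ht.1.le, ht.2.le⟩
        replace a1 := a1 (K ϱ t)
        replace a3 := a3 ϱ (K ϱ t) (hra.trans hε1) (hpsd ϱ t htt ht.2.le)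
        rw [one_mul] at he ⊢
        have hb1 : 1 ≤ Real.exp (L * (T - t)) := Real.one_le_exp (by nlinarith [ht.2])
        have hb2 := hexp t (h2.trans ht.1.le)
        rw [he] at a1 a3
        set B := Real.exp (L * (T - t))
        rw [norm_neg]
        have a4 : ‖R ϱ t (K ϱ t)‖ ≤ |ϱ| * (M * (1 + B) ^ 2) + M * (1 + B) := by
          have := norm_add_le_of_le a3 a1
          simpa using this
        have a5 : |ϱ| * (M * (1 + B) ^ 2) ≤ ε * (M * (4 * (B * S))) := by
          have : (1 + B) ^ 2 ≤ 4 * (B * S) := by nlinarith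
          gcongr
        nlinarith)
      t1 ⟨le_rfl, h3⟩
    rw [one_mul] at this
    exact this.trans (hexp t1 h2)
  have htb : ∀ ϱ ∈ Set.Icc (-ε) ε, tb ϱ < (t' : EReal) := by
    intro ϱ hϱ
    by_contra hc
    push Not at hc
    have hbot : ⊥ < tb ϱ := (EReal.bot_lt_coe t').trans_le hc
    have hb := hblow ϱ hbot
    obtain ⟨r, hr⟩ : ∃ r : ℝ, tb ϱ = (r : EReal) :=
      ⟨(tb ϱ).toReal, (EReal.coe_toReal (htbT ϱ).ne_top hbot.ne').symm⟩
    have hrT : r < T := by have := htbT ϱ; rw [hr] at this; exact_mod_cast this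
    have htr : t' ≤ r := by rw [hr] at hc; exact_mod_cast hc
    rw [hr, EReal.toReal_coe] at hb
    obtain ⟨s, hs1, hs2⟩ := ((hb.eventually (eventually_gt_atTop S)).and (Ioo_mem_nhdsGT hrT)).exists
    have := hbd ϱ hϱ s (by rw [hr]; exact_mod_cast hs2.1) (htr.trans hs2.1.le) hs2.2.le
    linarith
  have hbd' : ∀ ϱ ∈ Set.Icc (-ε) ε, ∀ t ∈ Set.Icc t' T, ‖K ϱ t‖ ≤ S := by
    intro ϱ hϱ t ht
    exact hbd ϱ hϱ t ((htb ϱ hϱ).trans_le (EReal.coe_le_coe_iff.2 ht.1)) ht.1 ht.2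
  refine ⟨ε, hε0, htb, ⟨S, hbd'⟩, ?_⟩
  set Q := M * (1 + S) ^ 2 + 1 with hQ
  have hdiff : ∀ ϱ ∈ Set.Icc (-ε) ε, ∀ t ∈ Set.Icc t' T, ‖K ϱ t - K 0 t‖ ≤ |ϱ| * Q * S := by
    intro ϱ hϱ
    have h0 : (0:ℝ) ∈ Set.Icc (-ε) ε := ⟨by linarith, hε0.le⟩
    rcases eq_or_ne ϱ 0 with rfl | hne
    · intro t ht; simp
    have hra : |ϱ| ≤ ε := abs_le.2 hϱ
    have hrp : 0 < |ϱ| := abs_pos.2 hne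
    have hcc : ∀ σ ∈ Set.Icc (-ε) ε, ContinuousOn (K σ) (Set.Icc t' T) := fun σ hσ =>
      (hcont σ).mono fun s hs => ⟨(htb σ hσ).trans_le (EReal.coe_le_coe_iff.2 hs.1), hs.2⟩
    have hdd : ∀ σ ∈ Set.Icc (-ε) ε, ∀ t ∈ Set.Ioo t' T, HasDerivAt (K σ) (-(R σ t (K σ t))) t :=
      fun σ hσ t ht => hode σ t ((htb σ hσ).trans (EReal.coe_lt_coe_iff.2 ht.1)) ht.2
    have hη : 0 < |ϱ| * Q := by positivity
    have := aux_cmp (fun t => K ϱ t - K 0 t) (fun t => -(R ϱ t (K ϱ t)) - -(R 0 t (K 0 t))) t' T L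
      (|ϱ| * Q) hη hL0 ((hcc ϱ hϱ).sub (hcc 0 h0)) (by simp [hterm])
      (fun t ht => (hdd ϱ hϱ t ht).sub (hdd 0 h0 t ht))
      (by
        intro t ht he
        obtain ⟨-, a2, a3⟩ := hRic t ⟨ht.1.le, ht.2.le⟩
        replace a2 := a2 (K ϱ t) (K 0 t)
        replace a3 := a3 ϱ (K ϱ t) (hra.trans hε1)
          (hpsd ϱ t ((htb ϱ hϱ).trans (EReal.coe_lt_coe_iff.2 ht.1)) ht.2.le)
        have hb1 : 1 ≤ Real.exp (L * (T - t)) := Real.one_le_exp (by nlinarith [ht.2])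
        rw [he] at a2
        set B := Real.exp (L * (T - t))
        have a4 : ‖-(R ϱ t (K ϱ t)) - -(R 0 t (K 0 t))‖ ≤
            |ϱ| * (M * (1 + ‖K ϱ t‖) ^ 2) + M * (|ϱ| * Q * B) := by
          have := norm_add_le_of_le a3 a2
          rw [sub_add_sub_cancel] at this
          rwa [neg_sub_neg, norm_sub_rev]
        have a5 : |ϱ| * (M * (1 + ‖K ϱ t‖) ^ 2) ≤ |ϱ| * (M * (1 + S) ^ 2) := by
          have := hbd' ϱ hϱ t ⟨ht.1.le, ht.2.le⟩
          gcongr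
        have a6 : |ϱ| * (M * (1 + S) ^ 2) < |ϱ| * Q := by rw [hQ]; gcongr; linarith
        have a7 : |ϱ| * Q ≤ |ϱ| * Q * B := le_mul_of_one_le_right hη.le hb1
        have a8 : 0 ≤ M * (|ϱ| * Q * B) := by positivity
        calc _ ≤ _ := a4
          _ < |ϱ| * Q * B + M * (|ϱ| * Q * B) := by linarith
          _ ≤ |ϱ| * Q * B * L := by rw [hL]; linarith)
    intro t ht
    refine (this t ht).trans ?_
    have := hexp t ht.1
    gcongr
  have hlim : Tendsto (fun ϱ : ℝ => |ϱ| * Q * S) (nhds 0) (nhds 0) := by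
    have : Continuous (fun ϱ : ℝ => |ϱ| * Q * S) := by fun_prop
    simpa using this.tendsto 0
  refine squeeze_zero' ?_ ?_ hlim
  · filter_upwards with ϱ
    apply Real.sSup_nonneg
    rintro _ ⟨t, -, rfl⟩
    exact norm_nonneg _
  · filter_upwards [Icc_mem_nhds (by linarith : -ε < 0) hε0] with ϱ hϱ
    apply csSup_le ((Set.nonempty_Icc.2 ht'.le).image _)
    rintro _ ⟨t, ht, rfl⟩
    exact hdiff ϱ hϱ t ht
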